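/- Let n ≥ 1 and let i_1,…,i_n, j be nonnegative integers satisfying i_1 + i_2 + ⋯ + i_n = j and i_1 + 2·i_2 + ⋯ + n·i_n = n. Then the rational number (n+j)! / ((n+1)! · i_1! · i_2! ⋯ i_n!) is an integer. -/

import Mathlib

open Finset Nat in
/-- Lowering one positive entry of a multi-index by one leaves a product of factorials that divides
the factorial of the lowered sum. -/
theorem prod_factorial_dvd_mul_factorial_sum_sub_one {ι : Type*} (s : Finset ι) (f : ι → ℕ)
    {k : ι} (hk : k ∈ s) : ∏ l ∈ s, (f l)! ∣ f k * (∑ l ∈ s, f l - 1)! := by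
  classical
  rcases Nat.eq_zero_or_pos (f k) with h | h
  · simp [h]
  have hsum : ∑ l ∈ s, f l - 1 = (f k - 1) + ∑ l ∈ s.erase k, f l := by
    rw [← add_sum_erase s f hk]
    omega
  rw [← mul_prod_erase s _ hk, ← mul_factorial_pred h.ne', mul_assoc, hsum]
  exact mul_dvd_mul_left _ <| (mul_dvd_mul_left _ (prod_factorial_dvd_factorial_sum _ f)).trans
    (factorial_mul_factorial_dvd_factorial_add _ _)

/-- **Integrality of the multinomial-type coefficient.**
If `n ≥ 1` and `i₁, …, iₙ, j` are nonnegative integers with `i₁ + ⋯ + iₙ = j` and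
`i₁ + 2 i₂ + ⋯ + n iₙ = n`, then `(n+j)! / ((n+1)! · i₁! ⋯ iₙ!)` is an integer, i.e.
`(n+1)! · i₁! ⋯ iₙ!` divides `(n+j)!`. -/
theorem factorial_quotient_integral (n : ℕ) (hn : 1 ≤ n) (j : ℕ) (i : Fin n → ℕ)
    (hsum : ∑ k, i k = j) (hwsum : ∑ k, (k.1 + 1) * i k = n) :
    ((n + 1).factorial * ∏ k, (i k).factorial) ∣ (n + j).factorial := by
  have hentry (k : Fin n) :
      ((n + 1).factorial * ∏ k, (i k).factorial) ∣ (n + j).factorial * i k := by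
    rcases Nat.eq_zero_or_pos (i k) with h | h
    · simp [h]
    have hkj : i k ≤ j := hsum ▸ Finset.single_le_sum (f := i) (by simp) (Finset.mem_univ k)
    have hnj : n + 1 + (j - 1) = n + j := by omega
    have hprod := prod_factorial_dvd_mul_factorial_sum_sub_one Finset.univ i (Finset.mem_univ k)
    rw [hsum] at hprod
    refine (mul_dvd_mul_left _ hprod).trans ?_
    rw [mul_left_comm, mul_comm _ (i k), ← hnj]
    exact mul_dvd_mul_left _ (Nat.factorial_mul_factorial_dvd_factorial_add _ _)
  have hn_mul : ((n + 1).factorial * ∏ k, (i k).factorial) ∣ (n + j).factorial * n := by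
    have h := Finset.dvd_sum fun k (_ : k ∈ Finset.univ) => (hentry k).mul_left (k.1 + 1)
    simpa only [mul_left_comm _ (n + j).factorial, ← Finset.mul_sum, hwsum] using h
  have hsucc_mul :
      ((n + 1).factorial * ∏ k, (i k).factorial) ∣ (n + j).factorial * (n + 1) := by
    rw [Nat.factorial_succ, mul_assoc, mul_comm _ (n + 1)]
    refine mul_dvd_mul_left _ ((mul_dvd_mul_left _ ?_).trans
      (Nat.factorial_mul_factorial_dvd_factorial_add n j))
    exact hsum ▸ Nat.prod_factorial_dvd_factorial_sum _ i
  rw [mul_add_one] at hsucc_mul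
  exact (Nat.dvd_add_right hn_mul).mp hsucc_mul
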